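/- arXiv:2002.12260 — 3 statements merged into one kernel-verified Lean document; each statement's English description precedes it below -/
import Mathlib

section
/- Let 1<p<∞ and 1<α<∞. Then there exist positive constants c₁,c₂,c₃, depending only on p and α, such that for every nonnegative ζ ∈ L^p(Π) with I(ζ) < ∞ and every x = (x₁,x₂) ∈ Π with x₂ ≥ 1, one has Gζ(x) ≤ x₂⁻¹(c₁ log x₂ + c₂) I(ζ) + c₃ x₂^{−1/α} ‖ζ‖_p^{1−1/α} I(ζ)^{1/α}. -/
open MeasureTheory Real Filter Topology

noncomputable section

/-- The open upper half-plane Π. -/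
def UHP : Set (ℝ × ℝ) := {x | 0 < x.2}

/-- Planar Lebesgue measure restricted to the upper half-plane. -/
def μUH : Measure (ℝ × ℝ) := MeasureTheory.volume.restrict UHP

/-- Squared Euclidean distance in the plane. -/
def sqdist (x y : ℝ × ℝ) : ℝ := (x.1 - y.1) ^ 2 + (x.2 - y.2) ^ 2

/-- Euclidean distance in the plane. -/
def euclDist (x y : ℝ × ℝ) : ℝ := Real.sqrt (sqdist x y)

/-- The Green's function of −Δ in the upper half-plane:
`G(x,y) = (1/(4π)) log(1 + 4 x₂ y₂ / |x−y|²)`. -/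
def greenG (x y : ℝ × ℝ) : ℝ :=
  (4 * π)⁻¹ * Real.log (1 + 4 * x.2 * y.2 / sqdist x y)

/-- The stream-function operator `𝒢ζ(x) = ∫_Π G(x,y) ζ(y) dy`. -/
def Gop (ζ : ℝ × ℝ → ℝ) (x : ℝ × ℝ) : ℝ := ∫ y, greenG x y * ζ y ∂μUH

/-- Kinetic energy `E(ζ) = (1/2) ∫_Π ζ 𝒢ζ`. -/
def energy (ζ : ℝ × ℝ → ℝ) : ℝ := (1 / 2) * ∫ x, ζ x * Gop ζ x ∂μUH

/-- Impulse `I(ζ) = ∫_Π ζ(y) y₂ dy`. -/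
def impulse (ζ : ℝ × ℝ → ℝ) : ℝ := ∫ y, ζ y * y.2 ∂μUH

/-- The `L^p(Π)` norm, as a real number. -/
def lpN (p : ℝ) (ζ : ℝ × ℝ → ℝ) : ℝ := (eLpNorm ζ (ENNReal.ofReal p) μUH).toReal

/-- `f ⪯ g` : `∫ (f−a)₊ ≤ ∫ (g−a)₊` for every `a > 0`. -/
def prec (f g : ℝ × ℝ → ℝ) : Prop :=
  ∀ a : ℝ, 0 < a → ∫ x, max (f x - a) 0 ∂μUH ≤ ∫ x, max (g x - a) 0 ∂μUH

/-- `f` is a rearrangement of `g` on Π. -/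
def IsRearr (f g : ℝ × ℝ → ℝ) : Prop :=
  ∀ a : ℝ, 0 < a → μUH {x | a < f x} = μUH {x | a < g x}

/-- Membership of the relaxed constraint class `𝒲(ζ₀)`. -/
def memW (ζ₀ ζ : ℝ × ℝ → ℝ) : Prop :=
  (∀ x, 0 ≤ ζ x) ∧ Integrable ζ μUH ∧ prec ζ ζ₀

/-- `𝒲(ζ₀, ≤ i₀)`. -/
def Wle (ζ₀ : ℝ × ℝ → ℝ) (i₀ : ℝ) : Set (ℝ × ℝ → ℝ) :=
  {ζ | memW ζ₀ ζ ∧ impulse ζ ≤ i₀}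

/-- `𝒲(ζ₀, i₀)`. -/
def Weq (ζ₀ : ℝ × ℝ → ℝ) (i₀ : ℝ) : Set (ℝ × ℝ → ℝ) :=
  {ζ | memW ζ₀ ζ ∧ impulse ζ = i₀}

/-- Membership of `ℛ⁺(ζ₀)`: restrictions of rearrangements of `ζ₀`. -/
def memRplus (ζ₀ ζ : ℝ × ℝ → ℝ) : Prop :=
  ∃ ξ : ℝ × ℝ → ℝ, ∃ A : Set (ℝ × ℝ), IsRearr ξ ζ₀ ∧ MeasurableSet A ∧
    ζ = A.indicator ξ

/-- Steiner symmetry about the `x₂`-axis. -/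
def SteinerSym (ζ : ℝ × ℝ → ℝ) : Prop :=
  ∀ᵐ t ∂(MeasureTheory.volume.restrict (Set.Ioi (0 : ℝ))),
    (∀ s : ℝ, ζ (-s, t) = ζ (s, t)) ∧
    (∀ s₁ s₂ : ℝ, 0 ≤ s₁ → s₁ ≤ s₂ → ζ (s₂, t) ≤ ζ (s₁, t))

/-- The decreasing rearrangement `ζ^Δ(s) = inf {a > 0 : |{ζ > a}| ≤ s}`. -/
def decRearr (ζ : ℝ × ℝ → ℝ) (s : ℝ) : ℝ :=
  sInf {a : ℝ | 0 < a ∧ μUH {x | a < ζ x} ≤ ENNReal.ofReal s}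

/-- The norm `‖ζ‖_{𝔛^p} = |I(ζ)| + ‖ζ‖₁ + ‖ζ‖_p`. -/
def XpNorm (p : ℝ) (ζ : ℝ × ℝ → ℝ) : ℝ := |impulse ζ| + lpN 1 ζ + lpN p ζ

/-- Distance to a set of functions in the `𝔛^p` norm. -/
def XpDist (p : ℝ) (ζ : ℝ × ℝ → ℝ) (S : Set (ℝ × ℝ → ℝ)) : ℝ :=
  sInf ((fun σ => XpNorm p fun x => ζ x - σ x) '' S)


lemma greenG_bound (ε : ℝ) (hε : 0 < ε) (x y : ℝ × ℝ) (hx : 1 ≤ x.2) (hy : 0 < y.2) :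
    Real.log (1 + 4 * x.2 * y.2 / sqdist x y) ≤
      (4 * Real.log x.2 + 48) * (y.2 / x.2) +
      ε⁻¹ * (if |x.1 - y.1| < 1/2 ∧ |x.2 - y.2| < 1/2 then sqdist x y ^ (-ε) else 0) := by
  have hx0 : 0 < x.2 := by linarith
  have hl : 0 ≤ Real.log x.2 := Real.log_nonneg hx
  have hs0 : 0 ≤ sqdist x y := by unfold sqdist; positivity
  have hr : 0 ≤ y.2 / x.2 := by positivity
  split_ifs with hQ
  · obtain ⟨h1, h2⟩ := hQ
    rcases hs0.eq_or_lt with hs | hs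
    · rw [← hs]; simp
      have : 0 ≤ (0:ℝ) ^ (-ε) := Real.rpow_nonneg le_rfl _
      positivity
    · have hs1 : sqdist x y ≤ 1 := by
        unfold sqdist
        have e1 := (sq_lt_sq' (by linarith [abs_nonneg (x.1-y.1)]) h1 : |x.1 - y.1| ^ 2 < (1/2)^2)
        have e2 := (sq_lt_sq' (by linarith [abs_nonneg (x.2-y.2)]) h2 : |x.2 - y.2| ^ 2 < (1/2)^2)
        rw [sq_abs] at e1 e2
        linarith
      rw [abs_lt] at h2
      have hr2 : 1/2 ≤ y.2 / x.2 := by rw [le_div_iff₀ hx0]; linarith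
      have hb : 1 + 4 * x.2 * y.2 / sqdist x y ≤ 7 * x.2 ^ 2 * (sqdist x y)⁻¹ := by
        rw [← div_eq_mul_inv, le_div_iff₀ hs, add_mul, div_mul_cancel₀ _ hs.ne']
        nlinarith
      have h3 : Real.log (7 * x.2 ^ 2 * (sqdist x y)⁻¹) =
          Real.log 7 + 2 * Real.log x.2 + Real.log (sqdist x y)⁻¹ := by
        rw [Real.log_mul (by positivity) (by positivity), Real.log_mul (by positivity) (by positivity),
          Real.log_pow]; norm_num
      have h4 : Real.log (sqdist x y)⁻¹ ≤ ε⁻¹ * sqdist x y ^ (-ε) := by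
        have := Real.log_le_rpow_div (inv_nonneg.2 hs0) hε
        rwa [Real.inv_rpow hs0, ← Real.rpow_neg hs0, div_eq_inv_mul] at this
      have h5 := Real.log_le_sub_one_of_pos (show (0:ℝ) < 7 by norm_num)
      have h6 := Real.log_le_log (by positivity) hb
      nlinarith
  · rw [mul_zero, add_zero]
    have hs : 1/4 ≤ sqdist x y := by
      unfold sqdist
      by_contra! h
      apply hQ
      constructor <;> apply abs_lt_of_sq_lt_sq _ (by norm_num) <;>
        nlinarith [sq_nonneg (x.1-y.1), sq_nonneg (x.2-y.2)]
    have hs' : 0 < sqdist x y := by linarith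
    by_cases hc : x.2 ^ 2 / 4 ≤ sqdist x y
    · have h1 := Real.log_le_sub_one_of_pos (show 0 < 1 + 4 * x.2 * y.2 / sqdist x y by positivity)
      have h2 : 4 * x.2 * y.2 / sqdist x y ≤ 4 * x.2 * y.2 / (x.2 ^ 2 / 4) := by gcongr
      have h3 : 4 * x.2 * y.2 / (x.2 ^ 2 / 4) = 16 * (y.2 / x.2) := by field_simp; norm_num
      nlinarith
    · push Not at hc
      have hb : |x.2 - y.2| < x.2 / 2 := by
        apply abs_lt_of_sq_lt_sq _ (by linarith)
        unfold sqdist at hc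
        nlinarith [sq_nonneg (x.1-y.1)]
      rw [abs_lt] at hb
      have hr2 : 1/2 ≤ y.2 / x.2 := by rw [le_div_iff₀ hx0]; linarith
      have hb : 1 + 4 * x.2 * y.2 / sqdist x y ≤ 25 * x.2 ^ 2 := by
        have : 4 * x.2 * y.2 / sqdist x y ≤ 4 * x.2 * y.2 / (1/4) := by gcongr
        have h : 4 * x.2 * y.2 / (1/4) = 16 * (x.2 * y.2) := by ring
        nlinarith
      have h3 : Real.log (25 * x.2 ^ 2) = Real.log 25 + 2 * Real.log x.2 := by
        rw [Real.log_mul (by positivity) (by positivity), Real.log_pow]; norm_num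
      have h5 := Real.log_le_sub_one_of_pos (show (0:ℝ) < 25 by norm_num)
      have h6 := Real.log_le_log (by positivity) hb
      nlinarith

/-- one-dimensional weight -/
def wt (t : ℝ) : ENNReal := Set.indicator (Set.Ioo (-(1/2)) (1/2)) (fun t => ENNReal.ofReal (|t| ^ (-(1/2) : ℝ))) t

lemma wt_meas : Measurable wt := by
  unfold wt
  exact Measurable.indicator (by fun_prop) measurableSet_Ioo

lemma wt_fin : ∫⁻ t, wt t < ⊤ := by
  unfold wt
  rw [lintegral_indicator measurableSet_Ioo]
  have h1 : IntervalIntegrable (fun t : ℝ => |t| ^ (-(1/2) : ℝ)) volume 0 (1/2) := by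
    have := intervalIntegral.intervalIntegrable_rpow' (a := 0) (b := 1/2) (r := -(1/2)) (by norm_num)
    refine this.congr ?_
    intro t ht
    rw [Set.uIoc_of_le (by norm_num)] at ht
    simp only [abs_of_pos ht.1]
  have h2 : IntervalIntegrable (fun t : ℝ => |t| ^ (-(1/2) : ℝ)) volume (-(1/2)) 0 := by
    have := ((IntervalIntegrable.iff_comp_neg (by simp)).1 h1).symm
    simpa using this
  have h3 := h2.trans h1
  rw [intervalIntegrable_iff_integrableOn_Ioo_of_le (by norm_num)] at h3
  exact h3.lintegral_lt_top

/-- the constant -/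
def MM : ENNReal := ∫⁻ z : ℝ × ℝ, wt z.1 * wt z.2

lemma MM_fin : MM < ⊤ := by
  unfold MM
  rw [Measure.volume_eq_prod, lintegral_prod_mul wt_meas.aemeasurable wt_meas.aemeasurable]
  exact ENNReal.mul_lt_top wt_fin wt_fin

/-- local kernel -/
def locKer (ε : ℝ) (x y : ℝ × ℝ) : ℝ :=
  if |x.1 - y.1| < 1/2 ∧ |x.2 - y.2| < 1/2 then sqdist x y ^ (-ε) else 0

lemma ker_nonneg (ε : ℝ) (x y : ℝ × ℝ) : 0 ≤ locKer ε x y := by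
  unfold locKer; split_ifs
  · apply Real.rpow_nonneg; unfold sqdist; positivity
  · rfl

lemma ker_meas (ε : ℝ) (x : ℝ × ℝ) : Measurable (locKer ε x) := by
  unfold locKer
  refine Measurable.ite ?_ ?_ measurable_const
  · have m1 : Measurable fun y : ℝ × ℝ => |x.1 - y.1| := by fun_prop
    have m2 : Measurable fun y : ℝ × ℝ => |x.2 - y.2| := by fun_prop
    exact (measurableSet_lt m1 measurable_const).inter (measurableSet_lt m2 measurable_const)
  · unfold sqdist; fun_prop

lemma ker_int (ε q : ℝ) (hq : 0 < q) (he : ε * q = 1/2) (x : ℝ × ℝ) :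
    ∫⁻ y, ENNReal.ofReal (locKer ε x y) ^ q ≤ MM := by
  have hM : MM = ∫⁻ y : ℝ × ℝ, wt (x - y).1 * wt (x - y).2 := by
    unfold MM
    rw [lintegral_sub_left_eq_self (fun z : ℝ × ℝ => wt z.1 * wt z.2) x]
  rw [hM]
  have n1 : ∀ᵐ y : ℝ × ℝ, y.1 ≠ x.1 := by
    rw [Measure.volume_eq_prod]
    exact Measure.quasiMeasurePreserving_fst.ae (Measure.ae_ne volume x.1)
  have n2 : ∀ᵐ y : ℝ × ℝ, y.2 ≠ x.2 := by
    rw [Measure.volume_eq_prod]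
    exact Measure.quasiMeasurePreserving_snd.ae (Measure.ae_ne volume x.2)
  apply lintegral_mono_ae
  filter_upwards [n1, n2] with y h1 h2
  unfold locKer
  split_ifs with hQ
  · obtain ⟨g1, g2⟩ := hQ
    have a1 : 0 < |x.1 - y.1| := abs_pos.2 (sub_ne_zero.2 h1.symm)
    have a2 : 0 < |x.2 - y.2| := abs_pos.2 (sub_ne_zero.2 h2.symm)
    have hs0 : 0 ≤ sqdist x y := by unfold sqdist; positivity
    simp only [wt, Prod.fst_sub, Prod.snd_sub]
    have i1 : x.1 - y.1 ∈ Set.Ioo (-(1/2) : ℝ) (1/2) := abs_lt.1 g1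
    have i2 : x.2 - y.2 ∈ Set.Ioo (-(1/2) : ℝ) (1/2) := abs_lt.1 g2
    rw [Set.indicator_of_mem i1, Set.indicator_of_mem i2,
      ← ENNReal.ofReal_mul (by positivity), ENNReal.ofReal_rpow_of_nonneg (by positivity) hq.le]
    apply ENNReal.ofReal_le_ofReal
    rw [← Real.rpow_mul hs0, ← Real.mul_rpow a1.le a2.le]
    have : -ε * q = -(1/2) := by linarith
    rw [this]
    apply Real.rpow_le_rpow_of_nonpos (by positivity) _ (by norm_num)
    unfold sqdist
    rw [← sq_abs (x.1-y.1), ← sq_abs (x.2-y.2)]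
    nlinarith [sq_nonneg (|x.1-y.1| - |x.2-y.2|)]
  · simp [hq]

lemma ker_bound (p α : ℝ) (hp : 1 < p) (hα : 1 < α) (ε β r : ℝ) (hβ : α.HolderConjugate β)
    (hr : p.HolderConjugate r) (he : ε * (β * r) = 1/2)
    (ζ : ℝ × ℝ → ℝ) (h0 : ∀ x, 0 ≤ ζ x) (hζ : MemLp ζ (ENNReal.ofReal p) μUH)
    (hI : Integrable (fun y => ζ y * y.2) μUH) (x : ℝ × ℝ) (hx : 1 ≤ x.2) :
    ∫⁻ y, ENNReal.ofReal (locKer ε x y * ζ y) ∂μUH ≤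
      ENNReal.ofReal ((MM.toReal ^ (1/r) * lpN p ζ) ^ (1/β) * (2 / x.2 * impulse ζ) ^ (1/α)) := by
  have hx0 : 0 < x.2 := by linarith
  have hβ0 : 0 < β := hβ.symm.pos
  have hα0 : 0 < α := hβ.pos
  have hr0 : 0 < r := hr.symm.pos
  have hp0 : 0 < p := hr.pos
  set S : Set (ℝ × ℝ) := {y | x.2 / 2 ≤ y.2} with hS
  have hSm : MeasurableSet S := measurableSet_le measurable_const measurable_snd
  set f : ℝ × ℝ → ENNReal := fun y => ENNReal.ofReal (locKer ε x y)
  set g : ℝ × ℝ → ENNReal := fun y => ENNReal.ofReal (ζ y)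
  have hf : Measurable f := (ker_meas ε x).ennreal_ofReal
  have hg : AEMeasurable g μUH := hζ.1.aemeasurable.ennreal_ofReal
  have hgS : AEMeasurable g (μUH.restrict S) := hg.restrict
  have e1 : ∫⁻ y, ENNReal.ofReal (locKer ε x y * ζ y) ∂μUH = ∫⁻ y in S, f y * g y ∂μUH := by
    rw [← lintegral_indicator hSm]
    congr 1
    ext y
    by_cases hy : y ∈ S
    · rw [Set.indicator_of_mem hy, ENNReal.ofReal_mul (ker_nonneg _ _ _)]
    · rw [Set.indicator_of_notMem hy]
      have : locKer ε x y = 0 := by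
        unfold locKer
        rw [if_neg]
        rintro ⟨-, h⟩
        apply hy
        rw [abs_lt] at h
        show x.2 / 2 ≤ y.2
        linarith
      simp [this]
  have hsum : 1/β + 1/α = 1 := by
    have := hβ.inv_add_inv_eq_one
    simp only [one_div]; linarith
  have e2 : ∫⁻ y in S, f y * g y ∂μUH ≤
      (∫⁻ y in S, f y ^ β * g y ∂μUH) ^ (1/β) * (∫⁻ y in S, g y ∂μUH) ^ (1/α) := by
    have := ENNReal.lintegral_mul_le_Lp_mul_Lq (μUH.restrict S) hβ.symm
      (f := fun y => f y * g y ^ (1/β)) (g := fun y => g y ^ (1/α))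
      (hf.aemeasurable.mul (hgS.pow_const _)) (hgS.pow_const _)
    convert this using 3
    · simp only [Pi.mul_apply]
      rw [mul_assoc, ← ENNReal.rpow_add_of_nonneg _ _ (by positivity) (by positivity), hsum,
        ENNReal.rpow_one]
    · congr 1
      ext y
      rw [ENNReal.mul_rpow_of_nonneg _ _ hβ0.le, ← ENNReal.rpow_mul, one_div_mul_cancel hβ0.ne',
        ENNReal.rpow_one]
    · congr 1
      ext y
      rw [← ENNReal.rpow_mul, one_div_mul_cancel hα0.ne', ENNReal.rpow_one]
  have e3 : ∫⁻ y in S, g y ∂μUH ≤ ENNReal.ofReal (2 / x.2 * impulse ζ) := by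
    have hae : ∀ᵐ y ∂μUH, 0 < y.2 := ae_restrict_mem (measurableSet_lt measurable_const measurable_snd)
    have hnn : 0 ≤ᵐ[μUH] fun y => 2 / x.2 * (ζ y * y.2) := by
      filter_upwards [hae] with y hy
      have := h0 y
      show 0 ≤ _
      positivity
    unfold impulse
    rw [← integral_const_mul, ofReal_integral_eq_lintegral_ofReal (hI.const_mul _) hnn]
    calc ∫⁻ y in S, g y ∂μUH ≤ ∫⁻ y in S, ENNReal.ofReal (2 / x.2 * (ζ y * y.2)) ∂μUH := by
          apply setLIntegral_mono_ae' hSm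
          refine Eventually.of_forall fun y hy => ENNReal.ofReal_le_ofReal ?_
          have hy' : x.2 / 2 ≤ y.2 := hy
          have : 1 ≤ 2 / x.2 * y.2 := by
            rw [div_mul_eq_mul_div, le_div_iff₀ hx0]; linarith
          nlinarith [h0 y]
      _ ≤ _ := setLIntegral_le_lintegral _ _
  have e4 : ∫⁻ y in S, f y ^ β * g y ∂μUH ≤ ENNReal.ofReal (MM.toReal ^ (1/r) * lpN p ζ) := by
    have h1 := ENNReal.lintegral_mul_le_Lp_mul_Lq μUH hr.symm
      (f := fun y => f y ^ β) (g := g) (hf.pow_const _).aemeasurable hg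
    refine (setLIntegral_le_lintegral _ _).trans (h1.trans ?_)
    rw [ENNReal.ofReal_mul (by positivity)]
    gcongr
    · rw [← ENNReal.ofReal_rpow_of_nonneg ENNReal.toReal_nonneg (by positivity),
        ENNReal.ofReal_toReal MM_fin.ne]
      gcongr
      refine le_trans ?_ (ker_int ε (β * r) (by positivity) he x)
      simp only [← ENNReal.rpow_mul]
      exact setLIntegral_le_lintegral _ _
    · unfold lpN
      rw [ENNReal.ofReal_toReal hζ.2.ne, eLpNorm_eq_lintegral_rpow_enorm_toReal (by simpa using hp0) (by simp),
        ENNReal.toReal_ofReal hp0.le]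
      gcongr with y
      simp only [g]
      rw [Real.enorm_eq_ofReal (h0 y)]
  have hI0 : 0 ≤ impulse ζ := by
    apply integral_nonneg_of_ae
    have hae : ∀ᵐ y ∂μUH, 0 < y.2 := ae_restrict_mem (measurableSet_lt measurable_const measurable_snd)
    filter_upwards [hae] with y hy
    have := h0 y
    show 0 ≤ _
    positivity
  have hL0 : 0 ≤ lpN p ζ := ENNReal.toReal_nonneg
  rw [e1, ENNReal.ofReal_mul (by positivity),
    ← ENNReal.ofReal_rpow_of_nonneg (by positivity) (by positivity),
    ← ENNReal.ofReal_rpow_of_nonneg (by positivity) (by positivity)]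
  refine e2.trans ?_
  gcongr

/-- Lemma 1: decay estimate for the stream function high in the half-plane. -/
theorem stmt_0 (p α : ℝ) (hp : 1 < p) (hα : 1 < α) :
    ∃ c₁ c₂ c₃ : ℝ, 0 < c₁ ∧ 0 < c₂ ∧ 0 < c₃ ∧
      ∀ ζ : ℝ × ℝ → ℝ, (∀ x, 0 ≤ ζ x) →
        MemLp ζ (ENNReal.ofReal p) μUH →
        Integrable (fun y => ζ y * y.2) μUH →
        ∀ x : ℝ × ℝ, x ∈ UHP → 1 ≤ x.2 →
          Gop ζ x ≤ x.2⁻¹ * (c₁ * Real.log x.2 + c₂) * impulse ζ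
            + c₃ * x.2 ^ (-(1 / α)) * lpN p ζ ^ (1 - 1 / α) * impulse ζ ^ (1 / α) := by
  have hβ := Real.HolderConjugate.conjExponent hα
  have hr := Real.HolderConjugate.conjExponent hp
  set β := α.conjExponent
  set r := p.conjExponent
  have hβ0 : 0 < β := hβ.symm.pos
  have hr0 : 0 < r := hr.symm.pos
  have hα0 : 0 < α := hβ.pos
  obtain ⟨ε, hε, he⟩ : ∃ ε : ℝ, 0 < ε ∧ ε * (β * r) = 1/2 :=
    ⟨1/2 / (β * r), by positivity, by field_simp⟩
  have hπ := Real.pi_pos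
  set K : ℝ := (4 * π)⁻¹ * ε⁻¹ * ((MM.toReal ^ (1/r)) ^ (1/β) * 2 ^ (1/α)) with hK
  refine ⟨(4 * π)⁻¹ * 4, (4 * π)⁻¹ * 48, K + 1, by positivity, by positivity, by positivity, ?_⟩
  intro ζ h0 hζ hI x _ hx
  have hx0 : 0 < x.2 := by linarith
  have hb := ker_bound p α hp hα ε β r hβ hr he ζ h0 hζ hI x hx
  have hae : ∀ᵐ y ∂μUH, 0 < y.2 := ae_restrict_mem (measurableSet_lt measurable_const measurable_snd)
  have hI0 : 0 ≤ impulse ζ := by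
    apply integral_nonneg_of_ae
    filter_upwards [hae] with y hy
    have := h0 y
    show 0 ≤ _
    positivity
  have hL0 : 0 ≤ lpN p ζ := ENNReal.toReal_nonneg
  have hkm : AEStronglyMeasurable (fun y => locKer ε x y * ζ y) μUH :=
    (ker_meas ε x).aestronglyMeasurable.mul hζ.1
  have hk0 : 0 ≤ᵐ[μUH] fun y => locKer ε x y * ζ y :=
    Eventually.of_forall fun y => mul_nonneg (ker_nonneg _ _ _) (h0 y)
  have hki : Integrable (fun y => locKer ε x y * ζ y) μUH :=
    ⟨hkm, (hasFiniteIntegral_iff_ofReal hk0).2 (hb.trans_lt ENNReal.ofReal_lt_top)⟩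
  have hkb : ∫ y, locKer ε x y * ζ y ∂μUH ≤
      (MM.toReal ^ (1/r) * lpN p ζ) ^ (1/β) * (2 / x.2 * impulse ζ) ^ (1/α) := by
    rw [integral_eq_lintegral_of_nonneg_ae hk0 hkm]
    exact ENNReal.toReal_le_of_le_ofReal (by positivity) hb
  have hlog : 0 ≤ Real.log x.2 := Real.log_nonneg hx
  have main : Gop ζ x ≤ ∫ y, ((4 * π)⁻¹ * ((4 * Real.log x.2 + 48) / x.2) * (ζ y * y.2) +
      (4 * π)⁻¹ * ε⁻¹ * (locKer ε x y * ζ y)) ∂μUH := by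
    unfold Gop
    apply integral_mono_of_nonneg
    · filter_upwards [hae] with y hy
      refine mul_nonneg (mul_nonneg (by positivity) (Real.log_nonneg ?_)) (h0 y)
      have : 0 ≤ sqdist x y := by unfold sqdist; positivity
      have : 0 ≤ 4 * x.2 * y.2 / sqdist x y := by positivity
      linarith
    · exact (hI.const_mul _).add (hki.const_mul _)
    · filter_upwards [hae] with y hy
      have h1 := greenG_bound ε hε x y hx hy
      unfold greenG
      have h2 := mul_le_mul_of_nonneg_right
        (mul_le_mul_of_nonneg_left h1 (show 0 ≤ (4 * π)⁻¹ by positivity)) (h0 y)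
      refine h2.trans (le_of_eq ?_)
      unfold locKer
      ring
  rw [integral_add (hI.const_mul _) (hki.const_mul _), integral_const_mul, integral_const_mul] at main
  change _ ≤ _ * impulse ζ + _ at main
  have hsum : 1/β = 1 - 1/α := by
    have := hβ.inv_add_inv_eq_one
    simp only [one_div]; linarith
  have hk2 : (MM.toReal ^ (1/r) * lpN p ζ) ^ (1/β) * (2 / x.2 * impulse ζ) ^ (1/α) =
      ((MM.toReal ^ (1/r)) ^ (1/β) * 2 ^ (1/α)) *
        (x.2 ^ (-(1 / α)) * lpN p ζ ^ (1 - 1 / α) * impulse ζ ^ (1 / α)) := by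
    rw [Real.mul_rpow (by positivity) hL0, Real.mul_rpow (by positivity) hI0, div_eq_mul_inv 2 x.2,
      Real.mul_rpow (by positivity) (by positivity), Real.inv_rpow hx0.le, ← Real.rpow_neg hx0.le,
      hsum]
    ring
  have hX : 0 ≤ x.2 ^ (-(1 / α)) * lpN p ζ ^ (1 - 1 / α) * impulse ζ ^ (1 / α) := by positivity
  rw [hk2] at hkb
  have h3 := mul_le_mul_of_nonneg_left hkb (show 0 ≤ (4 * π)⁻¹ * ε⁻¹ by positivity)
  refine main.trans ?_
  have h4 : (4 * π)⁻¹ * ((4 * Real.log x.2 + 48) / x.2) * impulse ζ =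
    x.2⁻¹ * ((4 * π)⁻¹ * 4 * Real.log x.2 + (4 * π)⁻¹ * 48) * impulse ζ := by ring
  rw [h4]
  rw [← mul_assoc ((4 * π)⁻¹ * ε⁻¹) (_ * _), ← hK] at h3
  nlinarith
end
end

section
/- Let 1<p<∞ and 1/p+1/q = 1. Then there exists a positive constant c₄, depending only on p, such that for every nonnegative ζ ∈ L^p(Π) ∩ L¹(Π) and every x = (x₁,x₂) ∈ Π, one has Gζ(x) ≤ c₄ (‖ζ‖₁ + ‖ζ‖_p)(x₂^{1/q} + x₂²). -/
open MeasureTheory Real Filter Topology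

noncomputable section

/-- The truncated singular profile. -/
def kerProf (t : ℝ) : ℝ := (Set.Iio (1 : ℝ)).indicator (fun t => t⁻¹) t

lemma kerProf_nonneg {t : ℝ} (ht : 0 ≤ t) : 0 ≤ kerProf t := by
  unfold kerProf
  by_cases h : t ∈ Set.Iio (1 : ℝ)
  · rw [Set.indicator_of_mem h]; positivity
  · rw [Set.indicator_of_notMem h]

lemma kerProf_meas : Measurable kerProf :=
  (measurable_inv).indicator measurableSet_Iio

lemma kerProf_integrable : Integrable (fun z : ℝ × ℝ => kerProf ‖z‖) volume := by
  rw [integrable_fun_norm_addHaar]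
  have h1 : IntegrableOn (fun _ : ℝ => (1 : ℝ)) (Set.Ioo (0 : ℝ) 1) volume := by
    simp [integrableOn_const_iff]
  have h2 : Integrable ((Set.Ioo (0 : ℝ) 1).indicator (fun _ : ℝ => (1 : ℝ))) volume :=
    (integrable_indicator_iff measurableSet_Ioo).2 h1
  refine (h2.integrableOn (s := Set.Ioi 0)).congr_fun ?_ measurableSet_Ioi
  intro t ht
  have ht' : (0 : ℝ) < t := ht
  simp only [kerProf, Module.finrank_prod, Module.finrank_self]
  by_cases h : t < 1
  · rw [Set.indicator_of_mem (show t ∈ Set.Ioo (0 : ℝ) 1 from ⟨ht', h⟩),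
      Set.indicator_of_mem (show t ∈ Set.Iio (1 : ℝ) from h)]
    simp [ht'.ne']
  · rw [Set.indicator_of_notMem (fun h' : t ∈ Set.Ioo (0 : ℝ) 1 => h h'.2),
      Set.indicator_of_notMem (show t ∉ Set.Iio (1 : ℝ) from h)]
    simp

lemma log_bound {a t : ℝ} (ha : 0 < a) (ha1 : a ≤ 1) (ht : 0 ≤ t) :
    Real.log (1 + t) ≤ a⁻¹ * t ^ a := by
  have h1 : (0 : ℝ) < 1 + t := by linarith
  have h2 : a * Real.log (1 + t) ≤ t ^ a := by
    rw [← Real.log_rpow h1]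
    have := Real.log_le_sub_one_of_pos (Real.rpow_pos_of_pos h1 a)
    have h3 := Real.rpow_add_le_add_rpow (zero_le_one) ht ha.le ha1
    rw [Real.one_rpow] at h3
    linarith
  rw [← div_eq_inv_mul, le_div_iff₀ ha]
  linarith

lemma green_nonneg {x y : ℝ × ℝ} (hx : 0 < x.2) (hy : 0 < y.2) : 0 ≤ greenG x y := by
  unfold greenG
  have : 0 ≤ sqdist x y := by unfold sqdist; positivity
  have : 0 ≤ 4 * x.2 * y.2 / sqdist x y := by positivity
  exact mul_nonneg (by positivity) (Real.log_nonneg (by linarith))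

lemma green_le {x y : ℝ × ℝ} (hx : 0 < x.2) (hy : 0 < y.2) (hxy : 0 < ‖y - x‖) :
    greenG x y ≤ Real.log (1 + 2 * x.2 / ‖y - x‖) := by
  set s := ‖y - x‖ with hs
  have h1 : |y.1 - x.1| ≤ s := norm_fst_le (y - x)
  have h2 : |y.2 - x.2| ≤ s := norm_snd_le (y - x)
  have h3 : s ^ 2 ≤ sqdist x y := by
    unfold sqdist
    rcases max_choice ‖(y - x).1‖ ‖(y - x).2‖ with h | h
    · rw [hs, Prod.norm_def, h, Real.norm_eq_abs, sq_abs]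
      simp only [Prod.fst_sub]; nlinarith [sq_nonneg (x.2 - y.2)]
    · rw [hs, Prod.norm_def, h, Real.norm_eq_abs, sq_abs]
      simp only [Prod.snd_sub]; nlinarith [sq_nonneg (x.1 - y.1)]
  have h4 : y.2 ≤ x.2 + s := by have := (abs_le.1 h2).2; linarith
  have hs2 : 0 < s ^ 2 := by positivity
  have h5 : 1 + 4 * x.2 * y.2 / sqdist x y ≤ (1 + 2 * x.2 / s) ^ 2 := by
    calc 1 + 4 * x.2 * y.2 / sqdist x y ≤ 1 + 4 * x.2 * (x.2 + s) / s ^ 2 := by gcongr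
      _ = (1 + 2 * x.2 / s) ^ 2 := by field_simp; ring
  have h6 : 0 ≤ 4 * x.2 * y.2 / sqdist x y := by
    have : 0 < sqdist x y := lt_of_lt_of_le hs2 h3
    positivity
  have h7 : Real.log (1 + 4 * x.2 * y.2 / sqdist x y) ≤ 2 * Real.log (1 + 2 * x.2 / s) := by
    have := Real.log_le_log (by linarith) h5
    rwa [Real.log_pow] at this
  have h8 : 0 ≤ Real.log (1 + 2 * x.2 / s) :=
    Real.log_nonneg (by have : 0 ≤ 2 * x.2 / s := by positivity
                        linarith)
  unfold greenG
  have hpi := Real.pi_gt_three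
  rw [← div_eq_inv_mul, div_le_iff₀ (by positivity)]
  nlinarith

lemma green_bound {a : ℝ} (ha : 0 < a) (ha1 : a ≤ 1) {x y : ℝ × ℝ}
    (hx : 0 < x.2) (hy : 0 < y.2) :
    greenG x y ≤ 2 * x.2 + a⁻¹ * (2 * x.2) ^ a * (kerProf ‖y - x‖) ^ a := by
  have hk := kerProf_nonneg (norm_nonneg (y - x))
  have hk' : 0 ≤ a⁻¹ * (2 * x.2) ^ a * (kerProf ‖y - x‖) ^ a := by positivity
  rcases (norm_nonneg (y - x)).eq_or_lt with h0 | h0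
  · have : y = x := by
      have := norm_eq_zero.1 h0.symm
      exact sub_eq_zero.1 this
    have h1 : greenG x y = 0 := by subst this; simp [greenG, sqdist]
    rw [h1]; positivity
  · refine (green_le hx hy h0).trans ?_
    have ht : 0 ≤ 2 * x.2 / ‖y - x‖ := by positivity
    by_cases h : ‖y - x‖ < 1
    · have h1 : kerProf ‖y - x‖ = ‖y - x‖⁻¹ := Set.indicator_of_mem (show _ ∈ Set.Iio (1 : ℝ) from h) _
      have h2 := log_bound ha ha1 ht
      rw [div_eq_mul_inv, Real.mul_rpow (by positivity) (by positivity)] at h2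
      rw [h1]
      rw [div_eq_mul_inv]
      nlinarith
    · push Not at h
      have h1 := Real.log_le_sub_one_of_pos (show 0 < 1 + 2 * x.2 / ‖y - x‖ by linarith)
      have h2 : 2 * x.2 / ‖y - x‖ ≤ 2 * x.2 := div_le_self (by positivity) h
      linarith

/-- Lemma 2: a global bound for the stream function. -/
theorem stmt_1 (p q : ℝ) (hp : 1 < p) (hpq : 1 / p + 1 / q = 1) :
    ∃ c₄ : ℝ, 0 < c₄ ∧
      ∀ ζ : ℝ × ℝ → ℝ, (∀ x, 0 ≤ ζ x) →
        MemLp ζ (ENNReal.ofReal p) μUH → Integrable ζ μUH →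
        ∀ x : ℝ × ℝ, x ∈ UHP →
          Gop ζ x ≤ c₄ * (lpN 1 ζ + lpN p ζ) * (x.2 ^ (1 / q) + x.2 ^ (2 : ℝ)) := by
  have hp0 : 0 < p := by linarith
  have hconj : p.HolderConjugate q := by
    rw [Real.holderConjugate_iff]
    exact ⟨hp, by simpa [one_div] using hpq⟩
  have hq0 : 0 < q := hconj.symm.pos
  have hq1 : 1 < q := hconj.symm.lt
  set a : ℝ := 1 / q with ha_def
  have ha : 0 < a := by positivity
  have ha1 : a ≤ 1 := by rw [ha_def, div_le_one hq0]; exact hq1.le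
  set A : ℝ := ∫ z : ℝ × ℝ, kerProf ‖z‖ with hA
  have hA0 : 0 ≤ A := integral_nonneg fun z => kerProf_nonneg (norm_nonneg z)
  refine ⟨2 + a⁻¹ * 2 ^ a * A ^ a, by positivity, ?_⟩
  intro ζ hζ0 hζp hζ1 x hx
  have hx0 : 0 < x.2 := hx
  set h := x.2 with hh
  set K : ℝ × ℝ → ℝ := fun y => (kerProf ‖y - x‖) ^ a with hK
  have hK0 : ∀ y, 0 ≤ K y := fun y => Real.rpow_nonneg (kerProf_nonneg (norm_nonneg _)) _
  have hKq : ∀ y, K y ^ q = kerProf ‖y - x‖ := fun y => by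
    simp only [hK]
    rw [← Real.rpow_mul (kerProf_nonneg (norm_nonneg _)), ha_def, one_div,
      inv_mul_cancel₀ hq0.ne', Real.rpow_one]
  have hint : Integrable (fun y : ℝ × ℝ => kerProf ‖y - x‖) volume :=
    kerProf_integrable.comp_sub_right x
  have hintA : ∫ y : ℝ × ℝ, kerProf ‖y - x‖ = A :=
    integral_sub_right_eq_self (fun z : ℝ × ℝ => kerProf ‖z‖) x
  have hKmeas : Measurable K := by
    have : Measurable fun y : ℝ × ℝ => ‖y - x‖ := by fun_prop
    exact (kerProf_meas.comp this).pow_const a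
  have hKmem : MemLp K (ENNReal.ofReal q) μUH := by
    rw [← integrable_norm_rpow_iff hKmeas.aestronglyMeasurable (by simpa using hq0) (by simp),
      ENNReal.toReal_ofReal hq0.le]
    have : (fun y => ‖K y‖ ^ q) = fun y => kerProf ‖y - x‖ := by
      funext y; rw [Real.norm_of_nonneg (hK0 y), hKq]
    rw [this]
    exact hint.integrableOn
  have hHol := integral_mul_le_Lp_mul_Lq_of_nonneg (μ := μUH) hconj (f := ζ) (g := K)
    (Eventually.of_forall hζ0) (Eventually.of_forall hK0) hζp hKmem
  have hl1 : lpN 1 ζ = ∫ y, ζ y ∂μUH := by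
    unfold lpN
    rw [ENNReal.ofReal_one, eLpNorm_one_eq_lintegral_enorm, ← integral_norm_eq_lintegral_enorm hζ1.1]
    exact integral_congr_ae (Eventually.of_forall fun y => Real.norm_of_nonneg (hζ0 y))
  have hlp : lpN p ζ = (∫ y, ζ y ^ p ∂μUH) ^ (1 / p) := by
    unfold lpN
    rw [hζp.eLpNorm_eq_integral_rpow_norm (by simpa using hp0) (by simp),
      ENNReal.toReal_ofReal hp0.le, ENNReal.toReal_ofReal (by positivity), one_div]
    congr 1
    exact integral_congr_ae (Eventually.of_forall fun y => by
      simp only [Real.norm_of_nonneg (hζ0 y)])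
  have hKint : ∫ y, K y ^ q ∂μUH ≤ A := by
    simp only [hKq]
    rw [← hintA]
    exact setIntegral_le_integral hint
      (Eventually.of_forall fun y => kerProf_nonneg (norm_nonneg _))
  have hKint0 : 0 ≤ ∫ y, K y ^ q ∂μUH :=
    integral_nonneg fun y => Real.rpow_nonneg (hK0 y) _
  have hlp0 : 0 ≤ lpN p ζ := ENNReal.toReal_nonneg
  have hl10 : 0 ≤ lpN 1 ζ := ENNReal.toReal_nonneg
  have hHol2 : ∫ y, ζ y * K y ∂μUH ≤ lpN p ζ * A ^ a := by
    refine hHol.trans ?_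
    rw [← hlp]
    gcongr
  have hprod : Integrable (fun y => ζ y * K y) μUH := by
    have : ENNReal.HolderConjugate (ENNReal.ofReal p) (ENNReal.ofReal q) := hconj.ennrealOfReal
    exact hζp.integrable_mul hKmem
  have hmain : Gop ζ x ≤ ∫ y, (2 * h * ζ y + a⁻¹ * (2 * h) ^ a * (ζ y * K y)) ∂μUH := by
    unfold Gop
    have hmem : ∀ᵐ y ∂μUH, y ∈ UHP :=
      ae_restrict_mem (measurableSet_lt measurable_const measurable_snd)
    refine integral_mono_of_nonneg ?_ ((hζ1.const_mul _).add (hprod.const_mul _)) ?_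
    · filter_upwards [hmem] with y hy
      exact mul_nonneg (green_nonneg hx0 hy) (hζ0 y)
    · filter_upwards [hmem] with y hy
      have := mul_le_mul_of_nonneg_right (green_bound ha ha1 hx0 hy) (hζ0 y)
      simp only [hK]
      linarith
  rw [integral_add (hζ1.const_mul _) (hprod.const_mul _), integral_const_mul, integral_const_mul,
    ← hl1, Real.mul_rpow (by norm_num) hx0.le] at hmain
  have hha : 0 ≤ h ^ a := by positivity
  have hh2 : 0 ≤ h ^ (2 : ℝ) := by positivity
  have hle : h ≤ h ^ a + h ^ (2 : ℝ) := by
    rcases le_total h 1 with h1 | h1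
    · have := Real.rpow_le_rpow_of_exponent_ge hx0 h1 ha1
      rw [Real.rpow_one] at this
      linarith
    · have := Real.rpow_le_rpow_of_exponent_le h1 (show (1 : ℝ) ≤ 2 by norm_num)
      rw [Real.rpow_one] at this
      linarith
  set S := h ^ a + h ^ (2 : ℝ) with hS
  have hS0 : 0 ≤ S := by positivity
  have haS : h ^ a ≤ S := by linarith
  set C := a⁻¹ * 2 ^ a * A ^ a with hC
  have hC0 : 0 ≤ C := by positivity
  calc Gop ζ x ≤ 2 * h * lpN 1 ζ + a⁻¹ * (2 ^ a * h ^ a) * ∫ y, ζ y * K y ∂μUH := hmain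
    _ ≤ 2 * h * lpN 1 ζ + a⁻¹ * (2 ^ a * h ^ a) * (lpN p ζ * A ^ a) := by gcongr
    _ = 2 * h * lpN 1 ζ + C * h ^ a * lpN p ζ := by rw [hC]; ring
    _ ≤ 2 * S * lpN 1 ζ + C * S * lpN p ζ := by gcongr
    _ ≤ (2 + C) * (lpN 1 ζ + lpN p ζ) * S := by
      have e1 : 0 ≤ C * lpN 1 ζ * S := by positivity
      have e2 : 0 ≤ 2 * lpN p ζ * S := by positivity
      nlinarith
end
end

section
/- Let 2<p<∞. Then there is a constant c₆>0, depending only on p, such that for every nonnegative ζ ∈ L^p(Π) ∩ L¹(Π) that is Steiner symmetric about the x₂-axis and has I(ζ) < ∞, one has Gζ(x) ≤ c₆ (I(ζ) + ‖ζ‖₁ + ‖ζ‖_p) x₂ min{1, |x₁|^{−1/(2p)}} for every x = (x₁,x₂) ∈ Π. -/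
open MeasureTheory Real Filter Topology

noncomputable section

open scoped ENNReal

lemma aux_green_le (x y : ℝ × ℝ) (hx : 0 < x.2) (hy : 0 < y.2) :
    greenG x y ≤ x.2 * (1 / euclDist x y) := by
  unfold greenG euclDist
  have hs : 0 ≤ sqdist x y := by unfold sqdist; positivity
  rcases hs.eq_or_lt with h | h
  · rw [← h]; simp
  have hr : 0 < √(sqdist x y) := Real.sqrt_pos.2 h
  set r := √(sqdist x y) with hrdef
  have hr2 : sqdist x y = r ^ 2 := (Real.sq_sqrt hs).symm
  have hyr : y.2 ≤ x.2 + r := by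
    have : (y.2 - x.2) ≤ r := by
      apply Real.le_sqrt_of_sq_le
      unfold sqdist; nlinarith [sq_nonneg (x.1 - y.1)]
    linarith
  have h1 : 1 + 4 * x.2 * y.2 / sqdist x y ≤ (1 + 2 * (x.2 / r)) ^ 2 := by
    rw [hr2]
    have : 4 * x.2 * y.2 / r ^ 2 ≤ 4 * x.2 * (x.2 + r) / r ^ 2 := by gcongr
    have e : 4 * x.2 * (x.2 + r) / r ^ 2 = 4 * (x.2/r)^2 + 4 * (x.2/r) := by
      field_simp
    nlinarith
  have h2 : Real.log (1 + 4 * x.2 * y.2 / sqdist x y) ≤ 4 * (x.2 / r) := by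
    calc _ ≤ Real.log ((1 + 2 * (x.2 / r)) ^ 2) := by
          apply Real.log_le_log _ h1
          positivity
      _ = 2 * Real.log (1 + 2 * (x.2 / r)) := by rw [Real.log_pow]; norm_num
      _ ≤ 2 * (2 * (x.2 / r)) := by
          have := Real.log_le_sub_one_of_pos (show 0 < 1 + 2 * (x.2 / r) by positivity)
          linarith
      _ = _ := by ring
  calc (4 * π)⁻¹ * Real.log (1 + 4 * x.2 * y.2 / sqdist x y) ≤ (4 * π)⁻¹ * (4 * (x.2 / r)) := by
        gcongr
    _ = π⁻¹ * (x.2 / r) := by field_simp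
    _ ≤ 1 * (x.2 / r) := by
        gcongr
        apply inv_le_one_of_one_le₀
        linarith [Real.pi_gt_three]
    _ = _ := by ring

lemma aux_muUH : μUH = (volume : Measure ℝ).prod (volume.restrict (Set.Ioi (0:ℝ))) := by
  have := Measure.prod_restrict (μ := (volume : Measure ℝ)) (ν := (volume : Measure ℝ))
    Set.univ (Set.Ioi (0:ℝ))
  rw [Measure.restrict_univ] at this
  rw [this, μUH, Measure.volume_eq_prod]
  congr 1
  ext z; simp [UHP]

lemma aux_strip1 (f : ℝ → ℝ≥0∞) (heven : ∀ s, f (-s) = f s)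
    (hanti : ∀ s₁ s₂ : ℝ, 0 ≤ s₁ → s₁ ≤ s₂ → f s₂ ≤ f s₁) (a : ℝ) (ha : 1 ≤ |a|) :
    ∫⁻ s, (Set.indicator {s : ℝ | |s - a| < √|a| / 2} f) s ≤
      ENNReal.ofReal (2 / √|a|) * ∫⁻ s, f s := by
  set X := |a| with hX
  have hq : 0 < √X := Real.sqrt_pos.2 (by linarith)
  have hqq : √X * √X = X := Real.mul_self_sqrt (by linarith)
  have hq1 : 1 ≤ √X := Real.one_le_sqrt.2 ha
  have habs : ∀ s, f |s| = f s := by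
    intro s
    rcases abs_choice s with h | h <;> rw [h]
    exact heven s
  have hset : {s : ℝ | |s - a| < √X / 2} = Set.Ioo (a - √X/2) (a + √X/2) := by
    ext s; simp only [Set.mem_ofPred_eq, Set.mem_Ioo, abs_lt]
    constructor <;> rintro ⟨h1, h2⟩ <;> constructor <;> linarith
  have h1 : ∫⁻ s, (Set.indicator {s : ℝ | |s - a| < √X / 2} f) s ≤
      f (X/2) * ENNReal.ofReal (√X) := by
    calc _ ≤ ∫⁻ s, (Set.indicator {s : ℝ | |s - a| < √X / 2} (fun _ => f (X/2))) s := by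
          apply lintegral_mono
          intro s
          apply Set.indicator_le_indicator'
          intro hs
          rw [← habs s]
          apply hanti _ _ (by positivity)
          have := abs_sub_abs_le_abs_sub a s
          rw [abs_sub_comm] at this
          simp only [Set.mem_ofPred_eq] at hs
          nlinarith
      _ = _ := by
          rw [hset, lintegral_indicator measurableSet_Ioo, setLIntegral_const, Real.volume_Ioo]
          congr 2; ring
  have h2 : f (X/2) * ENNReal.ofReal (X/2) ≤ ∫⁻ s, f s := by
    calc f (X/2) * ENNReal.ofReal (X/2) = ∫⁻ s in Set.Ioc 0 (X/2), f (X/2) := by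
          rw [setLIntegral_const, Real.volume_Ioc]; simp
      _ ≤ ∫⁻ s in Set.Ioc 0 (X/2), f s := by
          apply setLIntegral_mono' measurableSet_Ioc
          intro s hs
          exact hanti _ _ hs.1.le hs.2
      _ ≤ _ := setLIntegral_le_lintegral _ _
  calc _ ≤ f (X/2) * ENNReal.ofReal (√X) := h1
    _ = ENNReal.ofReal (2/√X) * (f (X/2) * ENNReal.ofReal (X/2)) := by
        rw [mul_left_comm, ← ENNReal.ofReal_mul (by positivity)]
        congr 2
        field_simp
        nlinarith
    _ ≤ _ := by gcongr

def auxStrip (a d : ℝ) : Set (ℝ × ℝ) := {y | |y.1 - a| < d}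

lemma aux_strip_meas (a d : ℝ) : MeasurableSet (auxStrip a d) := by
  unfold auxStrip
  exact measurableSet_lt (by fun_prop) (by fun_prop)

lemma aux_strip2 (F : ℝ × ℝ → ℝ≥0∞) (hF : AEMeasurable F μUH)
    (h : ∀ᵐ t ∂(volume.restrict (Set.Ioi (0 : ℝ))),
      (∀ s : ℝ, F (-s, t) = F (s, t)) ∧
      (∀ s₁ s₂ : ℝ, 0 ≤ s₁ → s₁ ≤ s₂ → F (s₂, t) ≤ F (s₁, t))) (a : ℝ) (ha : 1 ≤ |a|) :
    ∫⁻ y, (auxStrip a (√|a| / 2)).indicator F y ∂μUH ≤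
      ENNReal.ofReal (2 / √|a|) * ∫⁻ y, F y ∂μUH := by
  have hF' := hF.indicator (aux_strip_meas a (√|a| / 2))
  rw [aux_muUH] at *
  rw [lintegral_prod_symm _ hF, lintegral_prod_symm _ hF', ← lintegral_const_mul' _ _ (by simp)]
  apply lintegral_mono_ae
  filter_upwards [h] with t ht
  have := aux_strip1 (fun s => F (s, t)) ht.1 ht.2 a ha
  refine le_trans (le_of_eq (lintegral_congr fun s => ?_)) this
  by_cases hs : |s - a| < √|a| / 2
  · rw [Set.indicator_of_mem (show (s, t) ∈ auxStrip a (√|a| / 2) from hs),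
      Set.indicator_of_mem (show s ∈ {s : ℝ | |s - a| < √|a| / 2} from hs)]
  · rw [Set.indicator_of_notMem (show (s, t) ∉ auxStrip a (√|a| / 2) from hs),
      Set.indicator_of_notMem (show s ∉ {s : ℝ | |s - a| < √|a| / 2} from hs)]

def auxK (q : ℝ) : ℝ → ℝ≥0∞ := Set.indicator (Set.Ioo (-1) 1) (fun a => ‖a‖ₑ ^ (-(q/2)))

lemma auxK_meas (q : ℝ) : Measurable (auxK q) := by
  unfold auxK
  exact Measurable.indicator (by fun_prop) measurableSet_Ioo

lemma auxK_fin (q : ℝ) (hq : q < 2) (hq0 : 0 < q) : ∫⁻ a, auxK q a ≠ ∞ := by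
  have h1 : IntegrableOn (fun x : ℝ => x ^ (-(q/2))) (Set.Ioc 0 1) := by
    have := intervalIntegral.intervalIntegrable_rpow' (a := 0) (b := 1) (r := -(q/2)) (by linarith)
    rwa [intervalIntegrable_iff, Set.uIoc_of_le zero_le_one] at this
  have h2 : ∫⁻ x in Set.Ioc (0:ℝ) 1, ‖x‖ₑ ^ (-(q/2)) ≠ ∞ := by
    have h3 := h1.2
    rw [hasFiniteIntegral_iff_enorm] at h3
    convert h3.ne using 1
    apply setLIntegral_congr_fun measurableSet_Ioc
    intro x hx
    simp only
    rw [Real.enorm_of_nonneg hx.1.le, ENNReal.ofReal_rpow_of_pos hx.1, Real.enorm_of_nonneg]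
    exact Real.rpow_nonneg hx.1.le _
  set g : ℝ → ℝ≥0∞ := Set.indicator (Set.Ioc 0 1) (fun a => ‖a‖ₑ ^ (-(q/2))) with hg
  have hgi : ∫⁻ x, g x ≠ ∞ := by
    rw [hg, lintegral_indicator measurableSet_Ioc]; exact h2
  have hgm : Measurable g := Measurable.indicator (by fun_prop) measurableSet_Ioc
  have hle : ∀ᵐ x : ℝ, auxK q x ≤ g x + g (-x) := by
    have : ∀ᵐ x : ℝ, x ≠ 0 := by simp [ae_iff]
    filter_upwards [this] with x hx
    unfold auxK
    by_cases hx1 : x ∈ Set.Ioo (-1:ℝ) 1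
    · rw [Set.indicator_of_mem hx1]
      rcases lt_or_gt_of_ne hx with h | h
      · have : -x ∈ Set.Ioc (0:ℝ) 1 := ⟨by linarith, by linarith [hx1.1]⟩
        rw [hg, Set.indicator_of_mem this, enorm_neg]
        exact le_add_self
      · have : x ∈ Set.Ioc (0:ℝ) 1 := ⟨h, hx1.2.le⟩
        rw [hg, Set.indicator_of_mem this]
        exact le_self_add
    · rw [Set.indicator_of_notMem hx1]; exact zero_le
  have := lintegral_mono_ae hle
  rw [lintegral_add_left hgm, lintegral_neg_eq_self] at this
  exact ne_top_of_le_ne_top (ENNReal.add_ne_top.2 ⟨hgi, hgi⟩) this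

/-- The local part of the kernel. -/
def auxL (x : ℝ × ℝ) : ℝ × ℝ → ℝ≥0∞ :=
  Set.indicator {y | euclDist x y < 1} (fun y => ENNReal.ofReal (1 / euclDist x y))

lemma aux_dist_meas (x : ℝ × ℝ) : Measurable (euclDist x) := by
  unfold euclDist sqdist; fun_prop

lemma auxL_meas (x : ℝ × ℝ) : Measurable (auxL x) := by
  have := aux_dist_meas x
  unfold auxL
  exact Measurable.indicator (by fun_prop) (measurableSet_lt this measurable_const)

lemma auxL_le (x y : ℝ × ℝ) (q : ℝ) (hq0 : 0 < q) :
    auxL x y ^ q ≤ auxK q (x.1 - y.1) * auxK q (x.2 - y.2) := by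
  unfold auxL
  by_cases h : y ∈ {y | euclDist x y < 1}
  swap
  · rw [Set.indicator_of_notMem h, ENNReal.zero_rpow_of_pos hq0]; exact zero_le
  rw [Set.indicator_of_mem h]
  simp only [Set.mem_ofPred_eq] at h
  have hr0 : 0 ≤ euclDist x y := Real.sqrt_nonneg _
  have hs : 0 ≤ sqdist x y := by unfold sqdist; positivity
  have hr : euclDist x y ^ 2 = (x.1 - y.1) ^ 2 + (x.2 - y.2) ^ 2 := Real.sq_sqrt hs
  set r := euclDist x y
  set a := x.1 - y.1
  set b := x.2 - y.2
  have ha : a ∈ Set.Ioo (-1 : ℝ) 1 := by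
    rw [Set.mem_Ioo, ← abs_lt, ← sq_lt_one_iff_abs_lt_one]; nlinarith [sq_nonneg b]
  have hb : b ∈ Set.Ioo (-1 : ℝ) 1 := by
    rw [Set.mem_Ioo, ← abs_lt, ← sq_lt_one_iff_abs_lt_one]; nlinarith [sq_nonneg a]
  rw [auxK, Set.indicator_of_mem ha, Set.indicator_of_mem hb]
  have hz : ∀ c : ℝ, ‖c‖ₑ ^ (-(q/2)) ≠ 0 := by
    intro c hc
    rw [ENNReal.rpow_eq_zero_iff] at hc
    rcases hc with ⟨_, h2⟩ | ⟨h1, _⟩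
    · linarith
    · exact enorm_ne_top h1
  have hzz : ‖(0:ℝ)‖ₑ ^ (-(q/2)) = ∞ := by
    rw [enorm_zero, ENNReal.zero_rpow_of_neg (by linarith)]
  by_cases ha0 : a = 0
  · rw [ha0, hzz, ENNReal.top_mul (hz _)]; exact le_top
  by_cases hb0 : b = 0
  · rw [hb0, hzz, ENNReal.mul_top (hz _)]; exact le_top
  have ha1 : 0 < |a| := abs_pos.2 ha0
  have hb1 : 0 < |b| := abs_pos.2 hb0
  have hrp : 0 < r := by
    rcases hr0.eq_or_lt with h0 | h0
    · rw [← h0] at hr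
      have := sq_pos_of_pos ha1
      rw [sq_abs] at this
      nlinarith [sq_nonneg b]
    · exact h0
  rw [← enorm_abs a, ← enorm_abs b, Real.enorm_of_nonneg ha1.le, Real.enorm_of_nonneg hb1.le,
    ENNReal.ofReal_rpow_of_pos ha1, ENNReal.ofReal_rpow_of_pos hb1,
    ENNReal.ofReal_rpow_of_pos (by positivity), ← ENNReal.ofReal_mul (by positivity),
    ← Real.mul_rpow ha1.le hb1.le]
  apply ENNReal.ofReal_le_ofReal
  have e : (1 / r) ^ q = (r ^ 2) ^ (-(q/2)) := by
    rw [← Real.rpow_natCast, ← Real.rpow_mul hrp.le, one_div, Real.inv_rpow hrp.le,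
      ← Real.rpow_neg hrp.le]
    congr 1; push_cast; ring
  rw [e]
  apply Real.rpow_le_rpow_of_nonpos (by positivity) _ (by linarith)
  rw [hr, ← sq_abs a, ← sq_abs b]
  nlinarith [sq_nonneg (|a| - |b|)]

lemma auxL_int (x : ℝ × ℝ) (q : ℝ) (hq0 : 0 < q) :
    ∫⁻ y, auxL x y ^ q ∂μUH ≤ (∫⁻ a, auxK q a) ^ 2 := by
  have hm := auxK_meas q
  calc _ ≤ ∫⁻ y, auxL x y ^ q := setLIntegral_le_lintegral _ _
    _ ≤ ∫⁻ y : ℝ × ℝ, auxK q (x.1 - y.1) * auxK q (x.2 - y.2) :=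
        lintegral_mono fun y => auxL_le x y q hq0
    _ = _ := by
        rw [Measure.volume_eq_prod, lintegral_prod_mul (f := fun s => auxK q (x.1 - s))
          (g := fun s => auxK q (x.2 - s)) (by fun_prop) (by fun_prop),
          lintegral_sub_left_eq_self (auxK q), lintegral_sub_left_eq_self (auxK q), sq]

lemma aux_main (p : ℝ) (hp : 2 < p) (ζ : ℝ × ℝ → ℝ) (hζ : AEMeasurable ζ μUH) (x : ℝ × ℝ)
    (S : Set (ℝ × ℝ)) (hS : MeasurableSet S) (d : ℝ) (hd : 0 < d)
    (hSd : ∀ y, y ∉ S → d ≤ euclDist x y) (θ : ℝ≥0∞)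
    (h1 : ∫⁻ y, S.indicator (fun y => ‖ζ y‖ₑ) y ∂μUH ≤ θ * ∫⁻ y, ‖ζ y‖ₑ ∂μUH)
    (h2 : ∫⁻ y, S.indicator (fun y => ‖ζ y‖ₑ ^ p) y ∂μUH ≤ θ * ∫⁻ y, ‖ζ y‖ₑ ^ p ∂μUH) :
    ∫⁻ y, ENNReal.ofReal (1 / euclDist x y) * ‖ζ y‖ₑ ∂μUH ≤
      (ENNReal.ofReal (1 / d) + θ) * eLpNorm ζ 1 μUH +
      ((∫⁻ a, auxK (p / (p - 1)) a) ^ 2) ^ (1 / (p / (p - 1))) * θ ^ (1 / p) *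
        eLpNorm ζ (ENNReal.ofReal p) μUH := by
  have hpq : (p / (p - 1)).HolderConjugate p := (Real.HolderConjugate.conjExponent (by linarith)).symm
  set q := p / (p - 1)
  have hL := auxL_meas x
  have hpt : ∀ y, ENNReal.ofReal (1 / euclDist x y) * ‖ζ y‖ₑ ≤
      (ENNReal.ofReal (1 / d) * ‖ζ y‖ₑ + S.indicator (fun y => ‖ζ y‖ₑ) y) +
        auxL x y * S.indicator (fun y => ‖ζ y‖ₑ) y := by
    intro y
    by_cases hy : y ∈ S
    · rw [Set.indicator_of_mem hy]
      by_cases hy2 : euclDist x y < 1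
      · rw [auxL, Set.indicator_of_mem (show y ∈ {y | euclDist x y < 1} from hy2)]
        exact le_add_self
      · have : ENNReal.ofReal (1 / euclDist x y) ≤ 1 := by
          rw [ENNReal.ofReal_le_one]
          push Not at hy2
          rw [div_le_one (by linarith)]; exact hy2
        calc _ ≤ 1 * ‖ζ y‖ₑ := by gcongr
          _ ≤ _ := by rw [one_mul]; exact le_add_self.trans le_self_add
    · calc _ ≤ ENNReal.ofReal (1 / d) * ‖ζ y‖ₑ := by
            gcongr
            exact hSd y hy
        _ ≤ _ := le_self_add.trans le_self_add
  have hz : AEMeasurable (fun y => ‖ζ y‖ₑ) μUH := hζ.enorm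
  have hzS : AEMeasurable (S.indicator (fun y => ‖ζ y‖ₑ)) μUH := hz.indicator hS
  have hN1 : eLpNorm ζ 1 μUH = ∫⁻ y, ‖ζ y‖ₑ ∂μUH := eLpNorm_one_eq_lintegral_enorm
  have hNp : eLpNorm ζ (ENNReal.ofReal p) μUH = (∫⁻ y, ‖ζ y‖ₑ ^ p ∂μUH) ^ (1 / p) := by
    rw [eLpNorm_eq_lintegral_rpow_enorm_toReal (by simp; linarith) (by simp),
      ENNReal.toReal_ofReal (by linarith)]
  have hH := ENNReal.lintegral_mul_le_Lp_mul_Lq μUH hpq hL.aemeasurable hzS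
  calc _ ≤ ∫⁻ y, ((ENNReal.ofReal (1 / d) * ‖ζ y‖ₑ + S.indicator (fun y => ‖ζ y‖ₑ) y) +
        auxL x y * S.indicator (fun y => ‖ζ y‖ₑ) y) ∂μUH := lintegral_mono hpt
    _ = ENNReal.ofReal (1 / d) * ∫⁻ y, ‖ζ y‖ₑ ∂μUH + ∫⁻ y, S.indicator (fun y => ‖ζ y‖ₑ) y ∂μUH +
        ∫⁻ y, auxL x y * S.indicator (fun y => ‖ζ y‖ₑ) y ∂μUH := by
      rw [lintegral_add_left' (by fun_prop), lintegral_add_left' (by fun_prop),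
        lintegral_const_mul' _ _ (by simp)]
    _ ≤ ENNReal.ofReal (1 / d) * ∫⁻ y, ‖ζ y‖ₑ ∂μUH + θ * ∫⁻ y, ‖ζ y‖ₑ ∂μUH +
        ((∫⁻ a, auxK q a) ^ 2) ^ (1 / q) * (θ * ∫⁻ y, ‖ζ y‖ₑ ^ p ∂μUH) ^ (1 / p) := by
      gcongr
      refine hH.trans ?_
      have hp0 : 0 ≤ 1 / p := by positivity
      have hq0 : 0 ≤ 1 / q := by have := hpq.pos; positivity
      gcongr
      · exact auxL_int x q hpq.pos
      · refine le_trans (lintegral_mono fun y => ?_) h2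
        by_cases hy : y ∈ S
        · simp [hy]
        · simp [hy]; linarith
    _ = _ := by
      rw [ENNReal.mul_rpow_of_nonneg _ _ (by positivity), ← hNp, hN1]
      ring

lemma aux_final (p : ℝ) (ζ : ℝ × ℝ → ℝ) (h0 : ∀ x, 0 ≤ ζ x)
    (hp : MemLp ζ (ENNReal.ofReal p) μUH) (h1 : Integrable ζ μUH) (x : ℝ × ℝ) (hx : x ∈ UHP)
    (A B : ℝ) (hA : 0 ≤ A) (hB : 0 ≤ B)
    (h : ∫⁻ y, ENNReal.ofReal (1 / euclDist x y) * ‖ζ y‖ₑ ∂μUH ≤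
      ENNReal.ofReal A * eLpNorm ζ 1 μUH + ENNReal.ofReal B * eLpNorm ζ (ENNReal.ofReal p) μUH) :
    Gop ζ x ≤ x.2 * (A * lpN 1 ζ + B * lpN p ζ) := by
  have hx' : 0 < x.2 := hx
  have hd := aux_dist_meas x
  have e1 : lpN 1 ζ = (eLpNorm ζ 1 μUH).toReal := by unfold lpN; simp
  have t1 : eLpNorm ζ 1 μUH ≠ ∞ := (memLp_one_iff_integrable.2 h1).2.ne
  have tp := hp.2.ne
  have hl0 : 0 ≤ lpN 1 ζ := ENNReal.toReal_nonneg
  have hlp : 0 ≤ lpN p ζ := ENNReal.toReal_nonneg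
  have hR : ENNReal.ofReal A * eLpNorm ζ 1 μUH + ENNReal.ofReal B * eLpNorm ζ (ENNReal.ofReal p) μUH
      = ENNReal.ofReal (A * lpN 1 ζ + B * lpN p ζ) := by
    rw [ENNReal.ofReal_add (by positivity) (by positivity), ENNReal.ofReal_mul hA,
      ENNReal.ofReal_mul hB, e1, lpN, ENNReal.ofReal_toReal t1, ENNReal.ofReal_toReal tp]
  rw [hR] at h
  have hE : ∀ y, ENNReal.ofReal (1 / euclDist x y) * ‖ζ y‖ₑ =
      ENNReal.ofReal (1 / euclDist x y * ζ y) := by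
    intro y
    rw [Real.enorm_of_nonneg (h0 y), ENNReal.ofReal_mul]
    exact div_nonneg zero_le_one (Real.sqrt_nonneg _)
  simp_rw [hE] at h
  have hnn : ∀ y, 0 ≤ 1 / euclDist x y * ζ y := fun y =>
    mul_nonneg (div_nonneg zero_le_one (Real.sqrt_nonneg _)) (h0 y)
  have hm : AEStronglyMeasurable (fun y => 1 / euclDist x y * ζ y) μUH := by
    apply AEStronglyMeasurable.mul _ h1.1
    exact Measurable.aestronglyMeasurable (by fun_prop)
  have hint : Integrable (fun y => 1 / euclDist x y * ζ y) μUH := by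
    refine ⟨hm, ?_⟩
    rw [hasFiniteIntegral_iff_ofReal (Eventually.of_forall hnn)]
    exact h.trans_lt ENNReal.ofReal_lt_top
  have hI : ∫ y, 1 / euclDist x y * ζ y ∂μUH ≤ A * lpN 1 ζ + B * lpN p ζ := by
    rw [integral_eq_lintegral_of_nonneg_ae (Eventually.of_forall hnn) hm]
    exact ENNReal.toReal_le_of_le_ofReal (by positivity) h
  have hUm : MeasurableSet UHP := measurableSet_lt measurable_const measurable_snd
  calc Gop ζ x ≤ ∫ y, x.2 * (1 / euclDist x y * ζ y) ∂μUH := by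
        unfold Gop
        apply integral_mono_of_nonneg
        · filter_upwards [ae_restrict_mem hUm] with y hy
          have hy' : 0 < y.2 := hy
          apply mul_nonneg _ (h0 y)
          unfold greenG
          apply mul_nonneg (by positivity)
          apply Real.log_nonneg
          have : 0 ≤ 4 * x.2 * y.2 / sqdist x y := by
            unfold sqdist; positivity
          linarith
        · exact hint.const_mul _
        · filter_upwards [ae_restrict_mem hUm] with y hy
          have := mul_le_mul_of_nonneg_right (aux_green_le x y hx' hy) (h0 y)
          linarith
    _ = x.2 * ∫ y, 1 / euclDist x y * ζ y ∂μUH := integral_const_mul _ _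
    _ ≤ _ := by gcongr

/-- Lemma 5: decay of the stream function of a Steiner-symmetric vorticity;
`min{1, |x₁|^{-1/(2p)}}` equals `1` when `|x₁| ≤ 1` and `|x₁|^{-1/(2p)}` otherwise. -/
theorem stmt_4 (p : ℝ) (hp : 2 < p) :
    ∃ c₆ : ℝ, 0 < c₆ ∧
      ∀ ζ : ℝ × ℝ → ℝ, (∀ x, 0 ≤ ζ x) →
        MemLp ζ (ENNReal.ofReal p) μUH → Integrable ζ μUH →
        Integrable (fun y => ζ y * y.2) μUH → SteinerSym ζ →
        ∀ x : ℝ × ℝ, x ∈ UHP →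
          Gop ζ x ≤ c₆ * (impulse ζ + lpN 1 ζ + lpN p ζ) * x.2 *
            (if |x.1| ≤ 1 then 1 else |x.1| ^ (-(1 / (2 * p)))) := by
  set q := p / (p - 1) with hq
  have hp1 : 0 < p - 1 := by linarith
  have hq0 : 0 < q := by positivity
  have hq2 : q < 2 := by rw [hq, div_lt_iff₀ hp1]; linarith
  set C : ℝ≥0∞ := ((∫⁻ a, auxK q a) ^ 2) ^ (1 / q) with hC
  have hCt : C ≠ ∞ := by
    apply ENNReal.rpow_ne_top_of_nonneg (by positivity)
    exact ENNReal.pow_ne_top (auxK_fin q hq2 hq0)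
  set c := C.toReal with hc
  have hc0 : 0 ≤ c := ENNReal.toReal_nonneg
  have hCc : C = ENNReal.ofReal c := (ENNReal.ofReal_toReal hCt).symm
  refine ⟨4 + 2 * c, by positivity, ?_⟩
  intro ζ h0 hmp h1 hI hsym x hx
  have hx' : 0 < x.2 := hx
  have hUm : MeasurableSet UHP := measurableSet_lt measurable_const measurable_snd
  have himp : 0 ≤ impulse ζ := by
    apply integral_nonneg_of_ae
    filter_upwards [ae_restrict_mem hUm] with y hy
    exact mul_nonneg (h0 y) (le_of_lt hy)
  have hl0 : 0 ≤ lpN 1 ζ := ENNReal.toReal_nonneg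
  have hlp : 0 ≤ lpN p ζ := ENNReal.toReal_nonneg
  have hζm : AEMeasurable ζ μUH := h1.1.aemeasurable
  -- it suffices to bound both coefficients
  have key : ∀ A B m : ℝ, 0 ≤ A → 0 ≤ B → 0 ≤ m → A ≤ 4 * m → B ≤ 2 * c * m →
      Gop ζ x ≤ x.2 * (A * lpN 1 ζ + B * lpN p ζ) →
      Gop ζ x ≤ (4 + 2 * c) * (impulse ζ + lpN 1 ζ + lpN p ζ) * x.2 * m := by
    intro A B m hA hB hm hA' hB' h
    have e1 : A * lpN 1 ζ ≤ (4 + 2 * c) * m * lpN 1 ζ := by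
      gcongr; nlinarith [mul_nonneg hc0 hm]
    have e2 : B * lpN p ζ ≤ (4 + 2 * c) * m * lpN p ζ := by
      gcongr; nlinarith
    have e3 : 0 ≤ (4 + 2 * c) * m * impulse ζ := by positivity
    calc _ ≤ _ := h
      _ ≤ x.2 * ((4 + 2 * c) * m * impulse ζ + (4 + 2 * c) * m * lpN 1 ζ
          + (4 + 2 * c) * m * lpN p ζ) := by gcongr; linarith
      _ = _ := by ring
  split_ifs with hx1
  · have hmain := aux_main p hp ζ hζm x Set.univ MeasurableSet.univ 1 one_pos (by simp) 1
      (by simp) (by simp)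
    refine key 2 c 1 (by norm_num) hc0 zero_le_one (by norm_num) (by linarith) ?_
    apply aux_final p ζ h0 hmp h1 x hx 2 c (by norm_num) hc0
    rw [← hCc]
    convert hmain using 3
    · norm_num
    · simp [hC, hq]
  · push Not at hx1
    have hX0 : 0 < |x.1| := by linarith
    have hs : 0 < √|x.1| := Real.sqrt_pos.2 hX0
    set X := |x.1| with hX
    have hmain := aux_main p hp ζ hζm x (auxStrip x.1 (√X / 2)) (aux_strip_meas _ _) (√X / 2)
      (by positivity) (by
        intro y hy
        simp only [auxStrip, Set.mem_ofPred_eq, not_lt] at hy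
        refine hy.trans ?_
        apply Real.abs_le_sqrt
        unfold sqdist
        nlinarith [sq_nonneg (x.2 - y.2)]) (ENNReal.ofReal (2 / √X))
      (by
        apply aux_strip2 _ hζm.enorm _ _ hx1.le
        filter_upwards [hsym] with t ht
        refine ⟨fun s => by rw [ht.1], fun s₁ s₂ hs1 hs2 => ?_⟩
        rw [Real.enorm_of_nonneg (h0 _), Real.enorm_of_nonneg (h0 _)]
        exact ENNReal.ofReal_le_ofReal (ht.2 _ _ hs1 hs2))
      (by
        apply aux_strip2 _ (hζm.enorm.pow_const _) _ _ hx1.le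
        filter_upwards [hsym] with t ht
        refine ⟨fun s => by rw [ht.1], fun s₁ s₂ hs1 hs2 => ?_⟩
        rw [Real.enorm_of_nonneg (h0 _), Real.enorm_of_nonneg (h0 _)]
        exact ENNReal.rpow_le_rpow (ENNReal.ofReal_le_ofReal (ht.2 _ _ hs1 hs2)) (by linarith))
    have hsX : 1 / √X = X ^ (-(1/2) : ℝ) := by
      rw [Real.sqrt_eq_rpow, Real.rpow_neg hX0.le, one_div]
    have h4 : 1 / (√X / 2) + 2 / √X = 4 * X ^ (-(1/2) : ℝ) := by
      rw [← hsX]; field_simp; norm_num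
    refine key (1 / (√X / 2) + 2 / √X) (c * (2 / √X) ^ (1 / p)) (X ^ (-(1 / (2 * p))))
      (by positivity) (by positivity) (by positivity) ?_ ?_ ?_
    · rw [h4]
      gcongr 4 * ?_
      apply Real.rpow_le_rpow_of_exponent_le hx1.le
      apply neg_le_neg
      apply one_div_le_one_div_of_le <;> linarith
    · have : (2 / √X) ^ (1 / p) ≤ 2 * X ^ (-(1 / (2 * p))) := by
        have e : 2 / √X = 2 * X ^ (-(1/2) : ℝ) := by rw [← hsX]; ring
        rw [e, Real.mul_rpow (by norm_num) (by positivity), ← Real.rpow_mul hX0.le]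
        have e2 : (-(1/2) * (1/p) : ℝ) = -(1 / (2 * p)) := by field_simp
        rw [e2]
        gcongr
        calc (2:ℝ) ^ (1/p) ≤ 2 ^ (1:ℝ) := by
              apply Real.rpow_le_rpow_of_exponent_le (by norm_num)
              rw [div_le_one (by linarith)]; linarith
          _ = 2 := by simp
      nlinarith
    · apply aux_final p ζ h0 hmp h1 x hx _ _ (by positivity) (by positivity)
      rw [ENNReal.ofReal_add (by positivity) (by positivity), ENNReal.ofReal_mul hc0, ← hCc,
        ← ENNReal.ofReal_rpow_of_pos (by positivity)]
      exact hmain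
end
end
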